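/- arXiv:1803.07660 — 3 statements merged into one kernel-verified Lean document; each statement's English description precedes it below -/
import Mathlib

section
/- For every tuple of causal state/belief feedback policies ψ_t : (ℝ^n)^t × (ℝ^q)^t → ℝ^m (giving inputs u_t = ψ_t(x^t, ζ^t), where x^t and ζ^t denote the state and belief histories up to time t) there exists a tuple of causal disturbance/belief feedback policies Ψ_t : (ℝ^d)^{t−1} × (ℝ^q)^t → ℝ^m (giving inputs u_t = Ψ_t(ξ^{t−1}, ζ^t)) such that for every disturbance sequence ξ ∈ (ℝ^d)^T and every belief sequence ζ ∈ (ℝ^q)^T the two closed-loop systems produce identical state trajectories and identical input trajectories. -/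
open Matrix

/-- The closed-loop dynamics `x_{t+1} = Aₜ xₜ + Bₜ ζₜ + Dₜ uₜ + Eₜ ξₜ` with initial state
`xInit`, for given disturbance, belief and input sequences (`0`-based time indexing:
stage `k : Fin T` of the recursion corresponds to time `t = k+1` of the paper). -/
def Dyn (T n m d q : ℕ) (xInit : Fin n → ℝ)
    (A : Fin T → Matrix (Fin n) (Fin n) ℝ)
    (B : Fin T → Matrix (Fin n) (Fin q) ℝ)
    (D : Fin T → Matrix (Fin n) (Fin m) ℝ)
    (E : Fin T → Matrix (Fin n) (Fin d) ℝ)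
    (ξ : Fin T → Fin d → ℝ) (ζ : Fin T → Fin q → ℝ)
    (x : Fin (T+1) → Fin n → ℝ) (u : Fin T → Fin m → ℝ) : Prop :=
  x 0 = xInit ∧
    ∀ k : Fin T,
      x k.succ = A k *ᵥ x k.castSucc + B k *ᵥ ζ k + D k *ᵥ u k + E k *ᵥ ξ k


/-- The state history generated up to time `k` by the feedback policy `ψ`; the entries after
time `k` are placeholders. -/
noncomputable def stateHistory {T n m d q : ℕ} (xInit : Fin n → ℝ)
    (A : Fin T → Matrix (Fin n) (Fin n) ℝ)
    (B : Fin T → Matrix (Fin n) (Fin q) ℝ)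
    (D : Fin T → Matrix (Fin n) (Fin m) ℝ)
    (E : Fin T → Matrix (Fin n) (Fin d) ℝ)
    (ψ : Fin T → (Fin (T+1) → Fin n → ℝ) → (Fin T → Fin q → ℝ) → Fin m → ℝ)
    (ξ : Fin T → Fin d → ℝ) (ζ : Fin T → Fin q → ℝ) : ℕ → Fin (T+1) → Fin n → ℝ
  | 0 => fun _ => xInit
  | k + 1 =>
    let h := stateHistory xInit A B D E ψ ξ ζ k
    if hk : k < T then
      let t : Fin T := ⟨k, hk⟩
      Function.update h t.succ
        (A t *ᵥ h t.castSucc + B t *ᵥ ζ t + D t *ᵥ ψ t h ζ + E t *ᵥ ξ t)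
    else h

section

variable {T n m d q : ℕ} {xInit : Fin n → ℝ}
  {A : Fin T → Matrix (Fin n) (Fin n) ℝ} {B : Fin T → Matrix (Fin n) (Fin q) ℝ}
  {D : Fin T → Matrix (Fin n) (Fin m) ℝ} {E : Fin T → Matrix (Fin n) (Fin d) ℝ}
  {ψ : Fin T → (Fin (T+1) → Fin n → ℝ) → (Fin T → Fin q → ℝ) → Fin m → ℝ}

/-- Causality of the generated history: it depends only on past disturbances and beliefs. -/
lemma stateHistory_congr
    (hψ : ∀ (k : Fin T) (x : Fin (T+1) → Fin n → ℝ) (ζ ζ' : Fin T → Fin q → ℝ),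
      (∀ s : Fin T, (s : ℕ) ≤ (k : ℕ) → ζ s = ζ' s) → ψ k x ζ = ψ k x ζ')
    {ξ ξ' : Fin T → Fin d → ℝ} {ζ ζ' : Fin T → Fin q → ℝ} (k : ℕ)
    (hξ : ∀ s : Fin T, (s : ℕ) < k → ξ s = ξ' s)
    (hζ : ∀ s : Fin T, (s : ℕ) < k → ζ s = ζ' s) :
    stateHistory xInit A B D E ψ ξ ζ k = stateHistory xInit A B D E ψ ξ' ζ' k := by
  induction k with
  | zero => rfl
  | succ k ih =>
    have ih := ih (fun s hs => hξ s (by omega)) (fun s hs => hζ s (by omega))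
    by_cases hk : k < T
    · simp only [stateHistory, dif_pos hk, ih]
      rw [hξ ⟨k, hk⟩ (Nat.lt_succ_self k), hζ ⟨k, hk⟩ (Nat.lt_succ_self k),
        hψ ⟨k, hk⟩ _ ζ ζ' fun s hs => hζ s (Nat.lt_succ_of_le hs)]
    · simp only [stateHistory, dif_neg hk, ih]

/-- The generated history agrees with any closed-loop trajectory of the policy. -/
lemma Dyn.stateHistory_eq
    (hψ : ∀ (k : Fin T) (x x' : Fin (T+1) → Fin n → ℝ) (ζ : Fin T → Fin q → ℝ),
      (∀ s : Fin (T+1), (s : ℕ) ≤ (k : ℕ) → x s = x' s) → ψ k x ζ = ψ k x' ζ)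
    {ξ : Fin T → Fin d → ℝ} {ζ : Fin T → Fin q → ℝ}
    {x : Fin (T+1) → Fin n → ℝ} {u : Fin T → Fin m → ℝ}
    (hx : Dyn T n m d q xInit A B D E ξ ζ x u) (hu : ∀ k, u k = ψ k x ζ)
    (k : ℕ) (s : Fin (T+1)) (hs : (s : ℕ) ≤ k) :
    stateHistory xInit A B D E ψ ξ ζ k s = x s := by
  induction k generalizing s with
  | zero =>
    obtain rfl : s = 0 := Fin.ext (by simpa using hs)
    exact hx.1.symm
  | succ k ih =>
    by_cases hk : k < T
    · simp only [stateHistory, dif_pos hk]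
      by_cases h : s = Fin.succ ⟨k, hk⟩
      · subst h
        rw [Function.update_self, hx.2, hu, ih (Fin.castSucc ⟨k, hk⟩) le_rfl,
          hψ ⟨k, hk⟩ _ x ζ ih]
      · rw [Function.update_of_ne h]
        refine ih s ?_
        have : (s : ℕ) ≠ k + 1 := fun h' => h (Fin.ext h')
        omega
    · simp only [stateHistory, dif_neg hk]
      exact ih s (by omega)

/-- The state trajectory is determined by the disturbances, beliefs and inputs. -/
lemma Dyn.state_unique {ξ : Fin T → Fin d → ℝ} {ζ : Fin T → Fin q → ℝ}
    {x x' : Fin (T+1) → Fin n → ℝ} {u : Fin T → Fin m → ℝ}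
    (hx : Dyn T n m d q xInit A B D E ξ ζ x u)
    (hx' : Dyn T n m d q xInit A B D E ξ ζ x' u) : x = x' := by
  funext s
  induction s using Fin.induction with
  | zero => rw [hx.1, hx'.1]
  | succ k ih => rw [hx.2, hx'.2, ih]

end

/-- one direction of Theorem 2: every causal state/belief feedback policy
`ψ` admits a causal disturbance/belief feedback policy `Ψ` (strictly causal in the
disturbances, causal in the beliefs) producing the same closed-loop state and input
trajectories for every disturbance and belief sequence. -/
theorem stmt1 (T n m d q : ℕ) (xInit : Fin n → ℝ)
    (A : Fin T → Matrix (Fin n) (Fin n) ℝ)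
    (B : Fin T → Matrix (Fin n) (Fin q) ℝ)
    (D : Fin T → Matrix (Fin n) (Fin m) ℝ)
    (E : Fin T → Matrix (Fin n) (Fin d) ℝ)
    (ψ : Fin T → (Fin (T+1) → Fin n → ℝ) → (Fin T → Fin q → ℝ) → Fin m → ℝ)
    (hψ : ∀ (k : Fin T) (x x' : Fin (T+1) → Fin n → ℝ) (ζ ζ' : Fin T → Fin q → ℝ),
      (∀ s : Fin (T+1), (s : ℕ) ≤ (k : ℕ) → x s = x' s) →
      (∀ s : Fin T, (s : ℕ) ≤ (k : ℕ) → ζ s = ζ' s) →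
      ψ k x ζ = ψ k x' ζ') :
    ∃ Ψ : Fin T → (Fin T → Fin d → ℝ) → (Fin T → Fin q → ℝ) → Fin m → ℝ,
      (∀ (k : Fin T) (ξ ξ' : Fin T → Fin d → ℝ) (ζ ζ' : Fin T → Fin q → ℝ),
        (∀ s : Fin T, (s : ℕ) < (k : ℕ) → ξ s = ξ' s) →
        (∀ s : Fin T, (s : ℕ) ≤ (k : ℕ) → ζ s = ζ' s) →
        Ψ k ξ ζ = Ψ k ξ' ζ') ∧
      ∀ (ξ : Fin T → Fin d → ℝ) (ζ : Fin T → Fin q → ℝ)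
        (x x' : Fin (T+1) → Fin n → ℝ) (u u' : Fin T → Fin m → ℝ),
        Dyn T n m d q xInit A B D E ξ ζ x u → (∀ k, u k = ψ k x ζ) →
        Dyn T n m d q xInit A B D E ξ ζ x' u' → (∀ k, u' k = Ψ k ξ ζ) →
        x = x' ∧ u = u' := by
  refine ⟨fun k ξ ζ => ψ k (stateHistory xInit A B D E ψ ξ ζ k) ζ, ?_, ?_⟩
  · intro k ξ ξ' ζ ζ' hξ hζ
    dsimp only
    rw [stateHistory_congr (fun k x ζ ζ' h => hψ k x x ζ ζ' (fun _ _ => rfl) h) k hξ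
      fun s hs => hζ s hs.le]
    exact hψ k _ _ ζ ζ' (fun _ _ => rfl) hζ
  · intro ξ ζ x x' u u' hx hu hx' hu'
    obtain rfl : u = u' := by
      funext k
      rw [hu, hu']
      refine hψ k _ _ ζ ζ (fun s hs => ?_) (fun _ _ => rfl)
      exact (hx.stateHistory_eq (fun k x x' ζ h => hψ k x x' ζ ζ h fun _ _ => rfl) hu k s hs).symm
    exact ⟨hx.state_unique hx', rfl⟩
end

section
/- Assume S is nonempty and bounded and that the P_k are complementary projections (P_kP_k = P_k, P_jP_k = 0 for j ≠ k, and Σ_{k=1}^K P_k = I). Then the two sets X_FS = {(x, y, z) ∈ ℝ^N × ℝ^K × ℝ^N : y ≥ 0 componentwise and there exists s ∈ S with x = Σ_{k=1}^K y_k P_k s + z} and X̂_FS = {(x, y, z) ∈ ℝ^N × ℝ^K × ℝ^N : y ≥ 0 componentwise and x ∈ X̂(y,z)} are equal. -/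
open Matrix

/-- The primitive set `S = {s : gₖ − Gₖ Pₖ s ∈ Kₖ for all k}`. -/
def primSet (N K : ℕ) (l : Fin K → ℕ)
    (Kc : ∀ k, ConvexCone ℝ (Fin (l k) → ℝ))
    (G : ∀ k, Matrix (Fin (l k)) (Fin N) ℝ)
    (g : ∀ k, Fin (l k) → ℝ)
    (P : Fin K → Matrix (Fin N) (Fin N) ℝ) : Set (Fin N → ℝ) :=
  {s | ∀ k, g k - G k *ᵥ (P k *ᵥ s) ∈ Kc k}

/-- The convex representation `X̂(y,z)` of the scaled and translated state forecast set. -/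
def hatX (N K : ℕ) (l : Fin K → ℕ)
    (Kc : ∀ k, ConvexCone ℝ (Fin (l k) → ℝ))
    (G : ∀ k, Matrix (Fin (l k)) (Fin N) ℝ)
    (g : ∀ k, Fin (l k) → ℝ)
    (P : Fin K → Matrix (Fin N) (Fin N) ℝ)
    (y : Fin K → ℝ) (z : Fin N → ℝ) : Set (Fin N → ℝ) :=
  {x | ∃ ν : Fin K → Fin N → ℝ,
        x = (∑ k, P k *ᵥ ν k) + z ∧
        ∀ k, y k • g k - G k *ᵥ (P k *ᵥ ν k) ∈ Kc k}

/-- A bounded set contains a ray only if the direction of the ray is zero. -/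
theorem eq_zero_of_isBounded_of_ray_mem {E : Type*} [NormedAddCommGroup E] [NormedSpace ℝ E]
    {S : Set E} (hS : Bornology.IsBounded S) {a v : E}
    (h : ∀ t : ℝ, 0 < t → a + t • v ∈ S) : v = 0 := by
  obtain ⟨C, hC⟩ := hS.exists_norm_le
  by_contra hv
  have hv' : 0 < ‖v‖ := norm_pos_iff.mpr hv
  have hC0 : 0 ≤ C := (norm_nonneg _).trans (hC _ (h 1 one_pos))
  set t : ℝ := (C + ‖a‖ + 1) / ‖v‖ with ht
  have ht0 : 0 < t := by positivity
  have hnorm : ‖t • v‖ = C + ‖a‖ + 1 := by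
    rw [norm_smul, Real.norm_of_nonneg ht0.le, ht, div_mul_cancel₀ _ hv'.ne']
  have htri : ‖t • v‖ ≤ ‖a + t • v‖ + ‖a‖ := by
    simpa using norm_sub_le (a + t • v) a
  linarith [hC _ (h t ht0)]

/-- Complementary projections recover each component of a sum of projected vectors. -/
theorem mulVec_sum_mulVec_of_orthogonal {ι n : Type*} [Fintype ι] [Fintype n]
    {P : ι → Matrix n n ℝ} (hPP : ∀ k, P k * P k = P k)
    (hPO : ∀ j k, j ≠ k → P j * P k = 0) (w : ι → n → ℝ) (j : ι) :
    P j *ᵥ (∑ k, P k *ᵥ w k) = P j *ᵥ w j := by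
  rw [Matrix.mulVec_sum, Finset.sum_eq_single j]
  · rw [Matrix.mulVec_mulVec, hPP]
  · intro k _ hk
    rw [Matrix.mulVec_mulVec, hPO j k hk.symm, Matrix.zero_mulVec]
  · simp

/-- If the primitive set is nonempty and bounded, a recession direction of the `k`-th conic
constraint has zero `k`-th component. -/
theorem mulVec_eq_zero_of_neg_mem_cone {N K : ℕ} {l : Fin K → ℕ}
    {Kc : ∀ k, ConvexCone ℝ (Fin (l k) → ℝ)}
    {G : ∀ k, Matrix (Fin (l k)) (Fin N) ℝ} {g : ∀ k, Fin (l k) → ℝ}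
    {P : Fin K → Matrix (Fin N) (Fin N) ℝ}
    (hSne : (primSet N K l Kc G g P).Nonempty)
    (hSbdd : Bornology.IsBounded (primSet N K l Kc G g P))
    (hPP : ∀ k, P k * P k = P k) (hPO : ∀ j k, j ≠ k → P j * P k = 0)
    {k : Fin K} {v : Fin N → ℝ} (hv : -(G k *ᵥ (P k *ᵥ v)) ∈ Kc k) :
    P k *ᵥ v = 0 := by
  obtain ⟨s, hs⟩ := hSne
  refine eq_zero_of_isBounded_of_ray_mem hSbdd (a := s) fun t ht j => ?_
  rcases eq_or_ne j k with rfl | hjk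
  · have hmem := (Kc j).add_mem (hs j) ((Kc j).smul_mem ht hv)
    rw [Matrix.mulVec_add, Matrix.mulVec_smul, Matrix.mulVec_mulVec, hPP,
      Matrix.mulVec_add, Matrix.mulVec_smul]
    convert hmem using 1
    rw [smul_neg]
    abel
  · rw [Matrix.mulVec_add, Matrix.mulVec_smul, Matrix.mulVec_mulVec, hPO j k hjk,
      Matrix.zero_mulVec, smul_zero, add_zero]
    exact hs j

/-- Proposition 1 of the paper: if `S` is nonempty and bounded and the `Pₖ`
are complementary projections, then the nonconvex representation `X_FS` and the convex
representation `X̂_FS` of the state forecast set coincide. -/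
theorem stmt7 (N K : ℕ) (hK : 1 ≤ K) (l : Fin K → ℕ)
    (Kc : ∀ k, ConvexCone ℝ (Fin (l k) → ℝ))
    (hK0 : ∀ k, (0 : Fin (l k) → ℝ) ∈ Kc k)
    (G : ∀ k, Matrix (Fin (l k)) (Fin N) ℝ)
    (g : ∀ k, Fin (l k) → ℝ)
    (P : Fin K → Matrix (Fin N) (Fin N) ℝ)
    (hSne : (primSet N K l Kc G g P).Nonempty)
    (hSbdd : Bornology.IsBounded (primSet N K l Kc G g P))
    (hPP : ∀ k, P k * P k = P k)
    (hPO : ∀ j k, j ≠ k → P j * P k = 0)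
    (hPI : (∑ k, P k) = 1) :
    {p : (Fin N → ℝ) × (Fin K → ℝ) × (Fin N → ℝ) |
        (∀ k, 0 ≤ p.2.1 k) ∧
        ∃ s ∈ primSet N K l Kc G g P,
          p.1 = (∑ k, p.2.1 k • (P k *ᵥ s)) + p.2.2} =
      {p : (Fin N → ℝ) × (Fin K → ℝ) × (Fin N → ℝ) |
        (∀ k, 0 ≤ p.2.1 k) ∧
        p.1 ∈ hatX N K l Kc G g P p.2.1 p.2.2} := by
  ext ⟨x, y, z⟩
  simp only [Set.mem_ofPred_eq]
  refine and_congr_right fun hy => ⟨?_, ?_⟩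
  · rintro ⟨s, hs, rfl⟩
    refine ⟨fun k => y k • s, by simp only [Matrix.mulVec_smul], fun k => ?_⟩
    rw [Matrix.mulVec_smul, Matrix.mulVec_smul, ← smul_sub]
    rcases (hy k).eq_or_lt with h0 | hpos
    · rw [← h0, zero_smul]
      exact hK0 k
    · exact (Kc k).smul_mem hpos (hs k)
  · rintro ⟨ν, rfl, hν⟩
    obtain ⟨s₀, hs₀⟩ := id hSne
    let w : Fin K → Fin N → ℝ := fun k => if y k = 0 then s₀ else (y k)⁻¹ • ν k
    have hw : ∀ j, P j *ᵥ (∑ k, P k *ᵥ w k) = P j *ᵥ w j :=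
      mulVec_sum_mulVec_of_orthogonal hPP hPO w
    refine ⟨∑ k, P k *ᵥ w k, fun k => ?_, ?_⟩
    · rw [hw]
      by_cases h0 : y k = 0
      · simpa only [w, if_pos h0] using hs₀ k
      · have hpos : 0 < y k := (hy k).lt_of_ne' h0
        have hmem := (Kc k).smul_mem (inv_pos.mpr hpos) (hν k)
        rw [smul_sub, inv_smul_smul₀ h0] at hmem
        simpa only [w, if_neg h0, Matrix.mulVec_smul] using hmem
    · congr 1
      refine Finset.sum_congr rfl fun k _ => ?_
      rw [hw]
      by_cases h0 : y k = 0
      · rw [h0, zero_smul]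
        refine mulVec_eq_zero_of_neg_mem_cone hSne hSbdd hPP hPO ?_
        simpa only [h0, zero_smul, zero_sub] using hν k
      · simp only [w, if_neg h0, Matrix.mulVec_smul, smul_inv_smul₀ h0]
end

section
/- For every y ∈ ℝ^K with y ≥ 0 componentwise and every z ∈ ℝ^N, the image of S under the scaled-translated map satisfies L_{y,z}(S) ⊆ X̂(y,z); consequently, for any sets Ξ ⊆ ℝ^r and any function f : ℝ^N × ℝ^r → ℝ, if f(ζ, ξ) ≤ 0 for all ζ ∈ X̂(y,z) and all ξ ∈ Ξ, then f(L_{y,z}(s), ξ) ≤ 0 for all s ∈ S and all ξ ∈ Ξ. -/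
open Matrix

/-- The scaled-translated map `L_{y,z}(s) = Σₖ yₖ Pₖ s + z`. -/
def Lmap (N K : ℕ)
    (P : Fin K → Matrix (Fin N) (Fin N) ℝ)
    (y : Fin K → ℝ) (z : Fin N → ℝ) (s : Fin N → ℝ) : Fin N → ℝ :=
  (∑ k, y k • (P k *ᵥ s)) + z


/-- Scaling a primitive point by nonnegative weights yields a feasible family for `hatX`. -/
theorem Lmap_mem_hatX {N K : ℕ} {l : Fin K → ℕ}
    {Kc : ∀ k, ConvexCone ℝ (Fin (l k) → ℝ)}
    (hK0 : ∀ k, (0 : Fin (l k) → ℝ) ∈ Kc k)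
    {G : ∀ k, Matrix (Fin (l k)) (Fin N) ℝ}
    {g : ∀ k, Fin (l k) → ℝ}
    {P : Fin K → Matrix (Fin N) (Fin N) ℝ}
    {y : Fin K → ℝ} (hy : ∀ k, 0 ≤ y k) (z : Fin N → ℝ)
    {s : Fin N → ℝ} (hs : s ∈ primSet N K l Kc G g P) :
    Lmap N K P y z s ∈ hatX N K l Kc G g P y z := by
  refine ⟨fun k => y k • s, by simp only [Lmap, mulVec_smul], fun k => ?_⟩
  rw [mulVec_smul, mulVec_smul, ← smul_sub]
  rcases (hy k).eq_or_lt with h | h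
  · rw [← h, zero_smul]
    exact hK0 k
  · exact (Kc k).smul_mem h (hs k)

/-- the forward inclusion `L_{y,z}(S) ⊆ X̂(y,z)` and the resulting transfer of
robust constraints from the communicated set `X̂(y,z)` to the primitive set `S`. -/
theorem stmt8 (N K : ℕ) (hK : 1 ≤ K) (l : Fin K → ℕ)
    (Kc : ∀ k, ConvexCone ℝ (Fin (l k) → ℝ))
    (hK0 : ∀ k, (0 : Fin (l k) → ℝ) ∈ Kc k)
    (G : ∀ k, Matrix (Fin (l k)) (Fin N) ℝ)
    (g : ∀ k, Fin (l k) → ℝ)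
    (P : Fin K → Matrix (Fin N) (Fin N) ℝ)
    (y : Fin K → ℝ) (hy : ∀ k, 0 ≤ y k) (z : Fin N → ℝ) :
    (∀ s ∈ primSet N K l Kc G g P, Lmap N K P y z s ∈ hatX N K l Kc G g P y z) ∧
    ∀ (r : ℕ) (Ξ : Set (Fin r → ℝ)) (f : (Fin N → ℝ) → (Fin r → ℝ) → ℝ),
      (∀ ζ ∈ hatX N K l Kc G g P y z, ∀ ξ ∈ Ξ, f ζ ξ ≤ 0) →
      ∀ s ∈ primSet N K l Kc G g P, ∀ ξ ∈ Ξ, f (Lmap N K P y z s) ξ ≤ 0 := by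
  exact ⟨fun _ hs => Lmap_mem_hatX hK0 hy z hs,
    fun _ _ _ hf _ hs ξ hξ => hf _ (Lmap_mem_hatX hK0 hy z hs) ξ hξ⟩
end
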